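/- Let ω be an aperiodic infinite word and let T = (T_1,…,T_n) be a bilateral weighted shift on K_ω with bounded weights Λ = {λ_u}_{u∈F_ω} satisfying λ_u > 0 for all u. Then the only closed subspaces of K_ω that are joint reducing subspaces for {T_1,…,T_n} are {0} and K_ω. -/

import Mathlib

open scoped ENNReal InnerProductSpace

noncomputable section

variable {n : ℕ}

/-- The element of the free group determined by a word (list of generators). -/
def wordProd (l : List (Fin n)) : FreeGroup (Fin n) := (l.map FreeGroup.of).prod

/-- The initial segment `ω_m = i_1 i_2 ⋯ i_m` of an infinite word `ω`. -/
def initSeg (ω : ℕ → Fin n) (m : ℕ) : List (Fin n) := List.ofFn fun j : Fin m => ω j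

/-- The set `F_ω = { v ω_m⁻¹ : v ∈ F_n^+, m ≥ 0 }` inside the free group. -/
def Fomega (ω : ℕ → Fin n) : Set (FreeGroup (Fin n)) :=
  {g | ∃ (v : List (Fin n)) (m : ℕ), g = wordProd v * (wordProd (initSeg ω m))⁻¹}

lemma genMul_mem (ω : ℕ → Fin n) (i : Fin n) {g : FreeGroup (Fin n)} (hg : g ∈ Fomega ω) :
    FreeGroup.of i * g ∈ Fomega ω := by
  obtain ⟨v, m, rfl⟩ := hg
  exact ⟨i :: v, m, by simp [wordProd, mul_assoc]⟩

/-- `K_ω = ℓ²(F_ω)`. -/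
abbrev Komega (ω : ℕ → Fin n) : Type _ := lp (fun _ : Fomega ω => ℂ) 2

/-- The standard orthonormal basis vector `ξ_u` of `K_ω`. -/
def xi (ω : ℕ → Fin n) (u : Fomega ω) : Komega ω := lp.single 2 u 1

/-- `iu` as an element of `F_ω`. -/
def gen (ω : ℕ → Fin n) (i : Fin n) (u : Fomega ω) : Fomega ω :=
  ⟨FreeGroup.of i * u.1, genMul_mem ω i u.2⟩

/-- `T = (T_1,…,T_n)` is the bilateral weighted shift on `K_ω` with (complex) weights `Λ`:
`T_i ξ_u = λ_{iu} ξ_{iu}`. -/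
def IsWeightedShift (ω : ℕ → Fin n) (Λ : Fomega ω → ℂ)
    (T : Fin n → Komega ω →L[ℂ] Komega ω) : Prop :=
  ∀ (i : Fin n) (u : Fomega ω), T i (xi ω u) = Λ (gen ω i u) • xi ω (gen ω i u)

/-- real-weight version -/
def IsWeightedShiftR (ω : ℕ → Fin n) (Λ : Fomega ω → ℝ)
    (T : Fin n → Komega ω →L[ℂ] Komega ω) : Prop :=
  ∀ (i : Fin n) (u : Fomega ω), T i (xi ω u) = (Λ (gen ω i u) : ℂ) • xi ω (gen ω i u)

/-- A closed subspace `H` is reducing for an operator `A` if `H` and `Hᗮ` are `A`-invariant. -/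
def Reduces {E : Type*} [NormedAddCommGroup E] [InnerProductSpace ℂ E]
    (A : E →L[ℂ] E) (H : Submodule ℂ E) : Prop :=
  (∀ x ∈ H, A x ∈ H) ∧ ∀ x ∈ Hᗮ, A x ∈ Hᗮ

/-- `w^k` for a finite word `w`. -/
def listPow (w : List (Fin n)) : ℕ → List (Fin n)
  | 0 => []
  | k + 1 => w ++ listPow w k

/-- A word is primitive if it is non-empty and not a proper power. -/
def Primitive (v : List (Fin n)) : Prop :=
  v ≠ [] ∧ ∀ (w : List (Fin n)) (j : ℕ), 2 ≤ j → v ≠ listPow w j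

/-- `ω = v v v ⋯`. -/
def IsPeriodicWord (ω : ℕ → Fin n) (v : List (Fin n)) : Prop :=
  v ≠ [] ∧ ∀ k : ℕ, initSeg ω (k * v.length) = listPow v k

/-- `ω = u v₀ v₀ v₀ ⋯` for some words `u, v₀` with `v₀` non-empty. -/
def EventuallyPeriodic (ω : ℕ → Fin n) : Prop :=
  ∃ N p : ℕ, 1 ≤ p ∧ ∀ m ≥ N, ω (m + p) = ω m

def Aperiodic (ω : ℕ → Fin n) : Prop := ¬EventuallyPeriodic ω

lemma wordProd_append (v w : List (Fin n)) : wordProd (v ++ w) = wordProd v * wordProd w := by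
  simp [wordProd]

lemma wordProd_eq_mk (l : List (Fin n)) :
    wordProd l = FreeGroup.mk (l.map fun i => (i, true)) := by
  induction l with
  | nil => rfl
  | cons i l ih =>
    rw [← List.singleton_append, wordProd_append, ih, List.map_append, ← FreeGroup.mul_mk]
    simp [wordProd, FreeGroup.of]

/-- The free monoid embeds in the free group. -/
lemma wordProd_injective : Function.Injective (wordProd (n := n)) := by
  intro v w h
  have hred (l : List (Fin n)) : FreeGroup.IsReduced (l.map fun i => (i, true)) := by
    rw [FreeGroup.IsReduced, List.isChain_map]
    exact List.Pairwise.isChain (List.pairwise_of_forall fun _ _ _ => rfl)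
  rw [wordProd_eq_mk, wordProd_eq_mk] at h
  have h' := congrArg FreeGroup.toWord h
  rw [FreeGroup.toWord_mk, FreeGroup.toWord_mk, (hred v).reduce_eq, (hred w).reduce_eq] at h'
  exact List.map_injective_iff.mpr (fun _ _ hab => congrArg Prod.fst hab) h'

/-- The factor of length `t` of the infinite word `ω` starting after its first `m` letters. -/
def factor (ω : ℕ → Fin n) (m t : ℕ) : List (Fin n) := (List.range' m t).map ω

@[simp]
lemma length_factor (ω : ℕ → Fin n) (m t : ℕ) : (factor ω m t).length = t := by
  simp [factor]

@[simp]
lemma getElem_factor (ω : ℕ → Fin n) (m t i : ℕ) (h : i < (factor ω m t).length) :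
    (factor ω m t)[i] = ω (m + i) := by
  simp [factor]

lemma factor_add (ω : ℕ → Fin n) (m s t : ℕ) :
    factor ω m (s + t) = factor ω m s ++ factor ω (m + s) t := by
  simp [factor, ← List.map_append, List.range'_append_1]

lemma initSeg_add (ω : ℕ → Fin n) (m t : ℕ) :
    initSeg ω (m + t) = initSeg ω m ++ factor ω m t := by
  refine List.ext_getElem (by simp [initSeg]) fun i h₁ h₂ => ?_
  rw [List.getElem_append]
  split_ifs with h
  · simp [initSeg]
  · have h' : m ≤ i := by simpa [initSeg] using h
    simp [initSeg, h']

/-- An element `v ω_m⁻¹` may be rewritten with a longer initial segment of `ω`. -/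
lemma wordProd_append_factor_mul (ω : ℕ → Fin n) (v : List (Fin n)) (m t : ℕ) :
    wordProd (v ++ factor ω m t) * (wordProd (initSeg ω (m + t)))⁻¹ =
      wordProd v * (wordProd (initSeg ω m))⁻¹ := by
  rw [initSeg_add, wordProd_append, wordProd_append]
  group

lemma Aperiodic.eq_of_shift_eq {ω : ℕ → Fin n} (hω : Aperiodic ω) {a b : ℕ}
    (h : ∀ x, ω (a + x) = ω (b + x)) : a = b := by
  wlog hab : a < b generalizing a b
  · rcases lt_trichotomy a b with h' | h' | h'
    · exact this h h'
    · exact h'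
    · exact (this (fun x => (h x).symm) h').symm
  refine (hω ⟨a, b - a, by lia, fun m hm => ?_⟩).elim
  have := h (m - a)
  rw [show a + (m - a) = m by lia, show b + (m - a) = m + (b - a) by lia] at this
  exact this.symm

/-- A word dividing `v ω_j⁻¹` on the left in `F_ω` is a prefix of `v` followed by an arbitrarily
long factor of `ω` starting after its first `j` letters. -/
lemma exists_prefix_of_wordProd_mul_eq (ω : ℕ → Fin n) (w v : List (Fin n)) (j : ℕ)
    {y : FreeGroup (Fin n)} (hy : y ∈ Fomega ω)
    (h : wordProd w * y = wordProd v * (wordProd (initSeg ω j))⁻¹) (k : ℕ) :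
    ∃ s, k ≤ s ∧ w <+: v ++ factor ω j s := by
  obtain ⟨r, l, rfl⟩ := hy
  rw [← wordProd_append_factor_mul ω r l (j + k), ← wordProd_append_factor_mul ω v j (l + k),
    ← mul_assoc, ← wordProd_append, show l + (j + k) = j + (l + k) by lia] at h
  exact ⟨l + k, by lia, _, wordProd_injective (mul_right_cancel h)⟩

/-- The words dividing an element of `F_ω` on the left determine it when `ω` is aperiodic. -/
lemma eq_of_forall_factor_dvd {ω : ℕ → Fin n} (hω : Aperiodic ω) (v v' : List (Fin n)) (m j : ℕ)
    (h : ∀ t, ∃ y ∈ Fomega ω, wordProd (v ++ factor ω m t) * y =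
      wordProd v' * (wordProd (initSeg ω j))⁻¹) :
    wordProd v * (wordProd (initSeg ω m))⁻¹ = wordProd v' * (wordProd (initSeg ω j))⁻¹ := by
  have hpre (t k : ℕ) : ∃ s, k ≤ s ∧ v ++ factor ω m t <+: v' ++ factor ω j s := by
    obtain ⟨y, hy, hyt⟩ := h t
    exact exists_prefix_of_wordProd_mul_eq ω _ v' j hy hyt k
  have hidx : m + v'.length = j + v.length := by
    refine hω.eq_of_shift_eq fun x => ?_
    obtain ⟨s, hs, hp⟩ := hpre (v'.length + x + 1) (v.length + x + 1)
    have := hp.getElem (i := v.length + v'.length + x) (by simp; lia)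
    rw [List.getElem_append_right (by lia), List.getElem_append_right (by lia),
      getElem_factor, getElem_factor] at this
    convert this using 2 <;> lia
  obtain ⟨s, hs, hp⟩ := hpre v'.length v.length
  have hp' : v' ++ factor ω j v.length <+: v' ++ factor ω j s := by
    obtain ⟨d, rfl⟩ := Nat.exists_eq_add_of_le hs
    rw [factor_add, ← List.append_assoc]
    exact List.prefix_append _ _
  have heq : v ++ factor ω m v'.length = v' ++ factor ω j v.length :=
    (List.prefix_of_prefix_length_le hp hp' (by simp; lia)).eq_of_length (by simp; lia)
  rw [← wordProd_append_factor_mul ω v m v'.length, ← wordProd_append_factor_mul ω v' j v.length,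
    heq, hidx]

lemma wordProd_mul_mem (ω : ℕ → Fin n) (w : List (Fin n)) {g : FreeGroup (Fin n)}
    (hg : g ∈ Fomega ω) : wordProd w * g ∈ Fomega ω := by
  obtain ⟨v, m, rfl⟩ := hg
  exact ⟨w ++ v, m, by rw [wordProd_append, mul_assoc]⟩

/-- The left action of a finite word on `F_ω`. -/
def wordMul (ω : ℕ → Fin n) (w : List (Fin n)) (u : Fomega ω) : Fomega ω :=
  ⟨wordProd w * u, wordProd_mul_mem ω w u.2⟩

lemma wordMul_cons (ω : ℕ → Fin n) (i : Fin n) (w : List (Fin n)) (u : Fomega ω) :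
    wordMul ω (i :: w) u = gen ω i (wordMul ω w u) :=
  Subtype.ext (by simp [wordMul, gen, wordProd, mul_assoc])

lemma wordMul_injective (ω : ℕ → Fin n) (w : List (Fin n)) :
    Function.Injective (wordMul ω w) := fun _ _ h =>
  Subtype.ext (mul_left_cancel (congrArg Subtype.val h))

lemma Aperiodic.exists_wordMul_eq_and_ne {ω : ℕ → Fin n} (hω : Aperiodic ω) {u u' : Fomega ω}
    (h : u ≠ u') : ∃ w y, wordMul ω w y = u ∧ ∀ x, wordMul ω w x ≠ u' := by
  obtain ⟨_, v, m, rfl⟩ := u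
  obtain ⟨_, v', j, rfl⟩ := u'
  by_contra! hcon
  refine h (Subtype.ext (eq_of_forall_factor_dvd hω v v' m j fun t => ?_))
  obtain ⟨x, hx⟩ := hcon (v ++ factor ω m t)
    ⟨(wordProd (initSeg ω (m + t)))⁻¹, [], m + t, by simp [wordProd]⟩
    (Subtype.ext (wordProd_append_factor_mul ω v m t))
  exact ⟨x, x.2, congrArg Subtype.val hx⟩

/-- A function on `F_ω` which is invariant under the action of words is constant. -/
lemma eq_of_forall_wordMul_eq {α : Type*} (ω : ℕ → Fin n) (f : Fomega ω → α)
    (hf : ∀ w u, f (wordMul ω w u) = f u) (u u' : Fomega ω) : f u = f u' := by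
  have key (u : Fomega ω) : f u = f ⟨1, [], 0, by simp [wordProd, initSeg]⟩ := by
    obtain ⟨_, v, m, rfl⟩ := u
    have hm : (wordProd (initSeg ω m))⁻¹ ∈ Fomega ω := ⟨[], m, by simp [wordProd]⟩
    calc _ = f ⟨_, hm⟩ := hf v ⟨_, hm⟩
      _ = f (wordMul ω (initSeg ω m) ⟨_, hm⟩) := (hf _ _).symm
      _ = _ := congrArg f (Subtype.ext (mul_inv_cancel _))
  rw [key u, key u']

lemma inner_xi_left (ω : ℕ → Fin n) (u : Fomega ω) (f : Komega ω) : ⟪xi ω u, f⟫_ℂ = f u := by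
  rw [xi, lp.inner_single_left]
  simp

lemma xi_apply_self (ω : ℕ → Fin n) (u : Fomega ω) : xi ω u u = 1 :=
  lp.single_apply_self ..

lemma xi_apply_ne (ω : ℕ → Fin n) {u u' : Fomega ω} (h : u' ≠ u) : xi ω u u' = 0 :=
  lp.single_apply_ne _ _ _ h

lemma IsWeightedShiftR.exists_prod_apply_xi {ω : ℕ → Fin n} {Λ : Fomega ω → ℝ}
    {T : Fin n → Komega ω →L[ℂ] Komega ω} (hT : IsWeightedShiftR ω Λ T) (hpos : ∀ u, 0 < Λ u)
    (w : List (Fin n)) (u : Fomega ω) :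
    ∃ c : ℂ, c ≠ 0 ∧ (w.map T).prod (xi ω u) = c • xi ω (wordMul ω w u) := by
  induction w with
  | nil => exact ⟨1, one_ne_zero, by simp [wordMul, wordProd]⟩
  | cons i w ih =>
    obtain ⟨c, hc, h⟩ := ih
    refine ⟨c * Λ (wordMul ω (i :: w) u),
      mul_ne_zero hc (Complex.ofReal_ne_zero.mpr (hpos _).ne'), ?_⟩
    rw [List.map_cons, List.prod_cons, mul_apply_eq_comp, h, map_smul, hT, smul_smul,
      wordMul_cons]

lemma IsWeightedShiftR.prod_apply_eq_zero {ω : ℕ → Fin n} {Λ : Fomega ω → ℝ}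
    {T : Fin n → Komega ω →L[ℂ] Komega ω} (hT : IsWeightedShiftR ω Λ T) (hpos : ∀ u, 0 < Λ u)
    {w : List (Fin n)} {u : Fomega ω} (hu : ∀ x, wordMul ω w x ≠ u) (f : Komega ω) :
    (w.map T).prod f u = 0 := by
  have hadj : ContinuousLinearMap.adjoint (w.map T).prod (xi ω u) = 0 := by
    ext x
    obtain ⟨c, -, h⟩ := hT.exists_prod_apply_xi hpos w x
    rw [← inner_xi_left, ContinuousLinearMap.adjoint_inner_right, h, inner_smul_left,
      inner_xi_left, xi_apply_ne ω (hu x)]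
    simp
  rw [← inner_xi_left, ← ContinuousLinearMap.adjoint_inner_left, hadj, inner_zero_left]

lemma Reduces.commute_starProjection {E : Type*} [NormedAddCommGroup E] [InnerProductSpace ℂ E]
    {A : E →L[ℂ] E} {H : Submodule ℂ E} [H.HasOrthogonalProjection] (h : Reduces A H) :
    Commute A H.starProjection := by
  ext x
  refine (Submodule.eq_starProjection_of_mem_orthogonal (u := A x)
    (h.1 _ (H.starProjection_apply_mem x)) ?_).symm
  rw [← map_sub]
  exact h.2 _ (H.sub_starProjection_mem_orthogonal x)

/-- The commutant of a weighted shift over an aperiodic word contains only scalar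
self-adjoint operators. -/
lemma IsWeightedShiftR.exists_eq_smul_of_commute {ω : ℕ → Fin n} (hω : Aperiodic ω)
    {Λ : Fomega ω → ℝ} {T : Fin n → Komega ω →L[ℂ] Komega ω} (hT : IsWeightedShiftR ω Λ T)
    (hpos : ∀ u, 0 < Λ u) {P : Komega ω →L[ℂ] Komega ω}
    (hP : (P : Komega ω →ₗ[ℂ] Komega ω).IsSymmetric) (hcomm : ∀ i, Commute (T i) P) :
    ∃ c : ℂ, ∀ f, P f = c • f := by
  have hprod (w : List (Fin n)) (f : Komega ω) :
      P ((w.map T).prod f) = (w.map T).prod (P f) := by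
    have : Commute (w.map T).prod P := by
      refine Commute.list_prod_left _ _ fun A hA => ?_
      obtain ⟨i, -, rfl⟩ := List.mem_map.mp hA
      exact hcomm i
    exact (DFunLike.congr_fun this.eq f).symm
  have hoff (u u' : Fomega ω) (h : u' ≠ u) : P (xi ω u) u' = 0 := by
    obtain ⟨w, y, rfl, hw⟩ := hω.exists_wordMul_eq_and_ne h.symm
    obtain ⟨c, hc, hcy⟩ := hT.exists_prod_apply_xi hpos w y
    have h0 := hT.prod_apply_eq_zero hpos hw (P (xi ω y))
    rw [← hprod, hcy, map_smul] at h0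
    exact (mul_eq_zero.mp h0).resolve_left hc
  have hdiag (u : Fomega ω) : P (xi ω u) = P (xi ω u) u • xi ω u := by
    ext u'
    rw [lp.coeFn_smul, Pi.smul_apply, smul_eq_mul]
    by_cases h : u' = u
    · rw [h, xi_apply_self, mul_one]
    · rw [hoff u u' h, xi_apply_ne ω h, mul_zero]
  have hinv (w : List (Fin n)) (u : Fomega ω) :
      P (xi ω (wordMul ω w u)) (wordMul ω w u) = P (xi ω u) u := by
    obtain ⟨c, hc, h⟩ := hT.exists_prod_apply_xi hpos w u
    have h1 := congrArg (fun f : Komega ω => f (wordMul ω w u)) (hprod w (xi ω u))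
    rw [hdiag u, map_smul, h, map_smul] at h1
    simp only [lp.coeFn_smul, Pi.smul_apply, smul_eq_mul, xi_apply_self, mul_one] at h1
    rw [mul_comm] at h1
    exact mul_right_cancel₀ hc h1
  have hconst := eq_of_forall_wordMul_eq ω (fun u => P (xi ω u) u) hinv
  let e : Fomega ω := ⟨1, [], 0, by simp [wordProd, initSeg]⟩
  refine ⟨starRingEnd ℂ (P (xi ω e) e), fun f => ?_⟩
  ext u
  rw [← inner_xi_left ω u (P f), ← ContinuousLinearMap.coe_coe, ← hP, ContinuousLinearMap.coe_coe,
    hdiag, inner_smul_left, inner_xi_left, hconst u e]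
  rfl

/-- for an aperiodic word `ω`, a bilateral weighted shift on `K_ω` has no
non-trivial joint reducing subspaces. -/
theorem aperiodic_weighted_shift_irreducible
    {n : ℕ} (hn : 2 ≤ n) (ω : ℕ → Fin n) (hω : Aperiodic ω)
    (Λ : Fomega ω → ℝ) (hbdd : ∃ C : ℝ, ∀ u, ‖Λ u‖ ≤ C) (hpos : ∀ u, 0 < Λ u)
    (T : Fin n → Komega ω →L[ℂ] Komega ω) (hT : IsWeightedShiftR ω Λ T)
    (H : Submodule ℂ (Komega ω)) (hH : IsClosed (H : Set (Komega ω)))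
    (hred : ∀ i : Fin n, Reduces (T i) H) :
    H = ⊥ ∨ H = ⊤ := by
  have : CompleteSpace H := hH.completeSpace_coe
  obtain ⟨c, hc⟩ := hT.exists_eq_smul_of_commute hω hpos H.starProjection_isSymmetric
    fun i => (hred i).commute_starProjection
  rcases eq_or_ne c 0 with rfl | h0
  · refine .inl ((Submodule.eq_bot_iff H).mpr fun x hx => ?_)
    rw [← Submodule.starProjection_eq_self_iff.mpr hx, hc, zero_smul]
  · refine .inr (Submodule.eq_top_iff'.mpr fun x => ?_)
    rw [← H.smul_mem_iff h0, ← hc]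
    exact H.starProjection_apply_mem x
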